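/- arXiv:2401.04466 — 2 statements merged into one kernel-verified Lean document; each statement's English description precedes it below -/
import Mathlib

section
/- Let n, k ∈ ℕ and I ⊂ ℝ be an interval. Let M = (M_1,…,M_n) and M* = (M*_1,…,M*_n) be sequences of symmetric continuous k-variable means on I with (M*_1(v),…,M*_n(v)) ≺ (M_1(v),…,M_n(v)) for all v ∈ I^k, and let S = (S_1,…,S_m) and S* = (S*_1,…,S*_m) (m < n) be sequences of symmetric continuous k-variable means on I with S embedded in M, S* embedded in M*, and (S_1(v),…,S_m(v)) ≺ (S*_1(v),…,S*_m(v)) for all v ∈ I^k. Then for every μ : I^n → ℝ continuous, symmetric, and strictly increasing in each variable, 𝒯_{S*,M*}(μ)(v) ≤ 𝒯_{S,M}(μ)(v) for all v ∈ I^k, where 𝒯_{S,M}(μ)(v) denotes the unique solution x of μ(S_1(v),…,S_m(v), x,…,x) = μ(M_1(v),…,M_n(v)) (with x repeated n−m times). -/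
/-- The nondecreasing rearrangement of a vector. -/
noncomputable def sortAsc {n : ℕ} (v : Fin n → ℝ) : Fin n → ℝ :=
  v ∘ Tuple.sort v

/-- The nonincreasing rearrangement of a vector. -/
noncomputable def sortDesc {n : ℕ} (v : Fin n → ℝ) : Fin n → ℝ :=
  fun k => sortAsc v k.rev

/-- `v ∈ ℝ^m` is ordered majorized by `w ∈ ℝ^n` (`m ≤ n`):
`v↓_k ≤ w↓_k` for all `k ∈ {1,…,m}`. -/
def OrdMaj {m n : ℕ} (h : m ≤ n) (v : Fin m → ℝ) (w : Fin n → ℝ) : Prop :=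
  ∀ k : Fin m, sortDesc v k ≤ sortDesc w (Fin.castLE h k)

/-- `v ∈ ℝ^m` is ordered minorized by `w ∈ ℝ^n` (`m ≤ n`):
`v↑_k ≥ w↑_k` for all `k ∈ {1,…,m}`. -/
def OrdMin {m n : ℕ} (h : m ≤ n) (v : Fin m → ℝ) (w : Fin n → ℝ) : Prop :=
  ∀ k : Fin m, sortAsc w (Fin.castLE h k) ≤ sortAsc v k

/-- `v` is embedded in `w`: it is both ordered majorized and ordered minorized by `w`. -/
def Embedded {m n : ℕ} (h : m ≤ n) (v : Fin m → ℝ) (w : Fin n → ℝ) : Prop :=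
  OrdMaj h v w ∧ OrdMin h v w

/-- The vector `(v_1,…,v_m,x,…,x)` of length `n` (`x` repeated `n - m` times). -/
def padRight {m n : ℕ} (v : Fin m → ℝ) (x : ℝ) : Fin n → ℝ :=
  fun i => if h : (i : ℕ) < m then v ⟨i, h⟩ else x

theorem aux_mono {n : ℕ} {I : Set ℝ} {μ : (Fin n → ℝ) → ℝ}
    (hμmono : ∀ u : Fin n → ℝ, (∀ i, u i ∈ I) → ∀ i : Fin n,
      StrictMonoOn (fun t => μ (Function.update u i t)) I)
    (u w : Fin n → ℝ) (hu : ∀ i, u i ∈ I) (hw : ∀ i, w i ∈ I) (h : ∀ i, u i ≤ w i) :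
    μ u ≤ μ w := by
  classical
  have key : ∀ s : Finset (Fin n), μ u ≤ μ (s.piecewise w u) := by
    intro s
    induction s using Finset.induction_on with
    | empty => simp
    | insert a s ha ih =>
      refine ih.trans ?_
      have hp : ∀ i, s.piecewise w u i ∈ I := by
        intro i
        by_cases hi : i ∈ s <;> simp [hi, hu, hw]
      have h1 := (hμmono _ hp a).monotoneOn (hu a) (hw a) (h a)
      rw [Finset.piecewise_insert]
      have h2 : Function.update (s.piecewise w u) a (u a) = s.piecewise w u := by
        have : u a = s.piecewise w u a := by simp [ha]
        rw [this, Function.update_eq_self]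
      simpa [h2] using h1
  simpa using key Finset.univ

theorem aux_strict {n : ℕ} {I : Set ℝ} {μ : (Fin n → ℝ) → ℝ}
    (hμmono : ∀ u : Fin n → ℝ, (∀ i, u i ∈ I) → ∀ i : Fin n,
      StrictMonoOn (fun t => μ (Function.update u i t)) I)
    (u w : Fin n → ℝ) (hu : ∀ i, u i ∈ I) (hw : ∀ i, w i ∈ I) (h : ∀ i, u i ≤ w i)
    (a : Fin n) (hlt : u a < w a) :
    μ u < μ w := by
  have h1 := hμmono u hu a (hu a) (hw a) hlt
  simp only [Function.update_eq_self] at h1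
  refine h1.trans_le (aux_mono hμmono _ _ ?_ hw ?_)
  · intro i
    by_cases hi : i = a
    · subst hi; simp [hw]
    · simp [hi, hu]
  · intro i
    by_cases hi : i = a
    · subst hi; simp
    · simp [hi, h]

theorem aux_perm {n : ℕ} (v w : Fin n → ℝ) (h : OrdMaj le_rfl v w) :
    ∃ σ : Equiv.Perm (Fin n), ∀ i, v i ≤ w (σ i) := by
  refine ⟨(Tuple.sort v).symm.trans (Tuple.sort w), fun i => ?_⟩
  have := h ((Tuple.sort v).symm i).rev
  simpa [sortDesc, sortAsc] using this

def auxEquiv {m n : ℕ} (h : m ≤ n) : Fin m ≃ {i : Fin n // (i : ℕ) < m} where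
  toFun i := ⟨Fin.castLE h i, i.2⟩
  invFun i := ⟨i.1, i.2⟩
  left_inv _ := rfl
  right_inv _ := rfl

theorem aux_pad {m n : ℕ} (h : m ≤ n) (v : Fin m → ℝ) (x : ℝ) (σ : Equiv.Perm (Fin m)) :
    (padRight (v ∘ σ) x : Fin n → ℝ) = padRight v x ∘ (σ.extendDomain (auxEquiv h)) := by
  funext i
  by_cases hi : (i : ℕ) < m
  · have := Equiv.Perm.extendDomain_apply_subtype σ (auxEquiv h) (b := i) hi
    rw [Function.comp_apply, this]
    simp [padRight, hi, auxEquiv]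
  · have := Equiv.Perm.extendDomain_apply_not_subtype σ (auxEquiv h) (b := i) hi
    simp [padRight, hi, this]

/-- comparability: if `M* ≺ M` (pointwise, as sequences of means),
`S ⊲ M`, `S* ⊲ M*` and `S ≺ S*` (with `|S| = |S*| = m < n`), then
`𝒯_{S*,M*}(μ) ≤ 𝒯_{S,M}(μ)` for every `μ ∈ CS_n(I)`. -/
theorem T_comparability (n k m : ℕ) (hk : 0 < k) (hmn : m < n)
    (I : Set ℝ) (hI : I.OrdConnected)
    (M Mstar : Fin n → (Fin k → ℝ) → ℝ)
    (hMmean : ∀ j v, (∀ i, v i ∈ I) → (⨅ i, v i) ≤ M j v ∧ M j v ≤ (⨆ i, v i))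
    (hMsym : ∀ j v, (∀ i, v i ∈ I) → ∀ σ : Equiv.Perm (Fin k), M j (v ∘ σ) = M j v)
    (hMcont : ∀ j, ContinuousOn (M j) {v : Fin k → ℝ | ∀ i, v i ∈ I})
    (hMstarmean : ∀ j v, (∀ i, v i ∈ I) → (⨅ i, v i) ≤ Mstar j v ∧ Mstar j v ≤ (⨆ i, v i))
    (hMstarsym : ∀ j v, (∀ i, v i ∈ I) → ∀ σ : Equiv.Perm (Fin k), Mstar j (v ∘ σ) = Mstar j v)
    (hMstarcont : ∀ j, ContinuousOn (Mstar j) {v : Fin k → ℝ | ∀ i, v i ∈ I})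
    (S Sstar : Fin m → (Fin k → ℝ) → ℝ)
    (hSmean : ∀ j v, (∀ i, v i ∈ I) → (⨅ i, v i) ≤ S j v ∧ S j v ≤ (⨆ i, v i))
    (hSsym : ∀ j v, (∀ i, v i ∈ I) → ∀ σ : Equiv.Perm (Fin k), S j (v ∘ σ) = S j v)
    (hScont : ∀ j, ContinuousOn (S j) {v : Fin k → ℝ | ∀ i, v i ∈ I})
    (hSstarmean : ∀ j v, (∀ i, v i ∈ I) → (⨅ i, v i) ≤ Sstar j v ∧ Sstar j v ≤ (⨆ i, v i))
    (hSstarsym : ∀ j v, (∀ i, v i ∈ I) → ∀ σ : Equiv.Perm (Fin k), Sstar j (v ∘ σ) = Sstar j v)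
    (hSstarcont : ∀ j, ContinuousOn (Sstar j) {v : Fin k → ℝ | ∀ i, v i ∈ I})
    (hMM : ∀ v : Fin k → ℝ, (∀ i, v i ∈ I) →
      OrdMaj le_rfl (fun j => Mstar j v) (fun j => M j v))
    (hSM : ∀ v : Fin k → ℝ, (∀ i, v i ∈ I) →
      Embedded hmn.le (fun j => S j v) (fun j => M j v))
    (hSMstar : ∀ v : Fin k → ℝ, (∀ i, v i ∈ I) →
      Embedded hmn.le (fun j => Sstar j v) (fun j => Mstar j v))
    (hSS : ∀ v : Fin k → ℝ, (∀ i, v i ∈ I) →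
      OrdMaj le_rfl (fun j => S j v) (fun j => Sstar j v))
    (μ : (Fin n → ℝ) → ℝ)
    (hμcont : ContinuousOn μ {u : Fin n → ℝ | ∀ i, u i ∈ I})
    (hμsym : ∀ u : Fin n → ℝ, (∀ i, u i ∈ I) → ∀ σ : Equiv.Perm (Fin n), μ (u ∘ σ) = μ u)
    (hμmono : ∀ u : Fin n → ℝ, (∀ i, u i ∈ I) → ∀ i : Fin n,
      StrictMonoOn (fun t => μ (Function.update u i t)) I)
    (K Kstar : (Fin k → ℝ) → ℝ)
    (hK : ∀ v : Fin k → ℝ, (∀ i, v i ∈ I) → K v ∈ I ∧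
      μ (padRight (fun j => S j v) (K v)) = μ (fun j => M j v))
    (hKstar : ∀ v : Fin k → ℝ, (∀ i, v i ∈ I) → Kstar v ∈ I ∧
      μ (padRight (fun j => Sstar j v) (Kstar v)) = μ (fun j => Mstar j v)) :
    ∀ v : Fin k → ℝ, (∀ i, v i ∈ I) → Kstar v ≤ K v := by
  intro v hv
  by_contra! hlt
  haveI : Nonempty (Fin k) := ⟨⟨0, hk⟩⟩
  have hmem : ∀ x, (⨅ i, v i) ≤ x ∧ x ≤ (⨆ i, v i) → x ∈ I := by
    intro x hx
    obtain ⟨a, ha⟩ := exists_eq_ciInf_of_finite (f := v)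
    obtain ⟨b, hb⟩ := exists_eq_ciSup_of_finite (f := v)
    rw [← ha, ← hb] at hx
    exact hI.out (hv a) (hv b) hx
  have hM := fun j => hmem _ (hMmean j v hv)
  have hMs := fun j => hmem _ (hMstarmean j v hv)
  have hS := fun j => hmem _ (hSmean j v hv)
  have hSs := fun j => hmem _ (hSstarmean j v hv)
  obtain ⟨hKI, hKe⟩ := hK v hv
  obtain ⟨hKsI, hKse⟩ := hKstar v hv
  have hpad : ∀ (s : Fin m → ℝ) (x : ℝ), (∀ j, s j ∈ I) → x ∈ I →
      ∀ i, (padRight s x : Fin n → ℝ) i ∈ I := by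
    intro s x hs hx i
    unfold padRight
    split_ifs
    · exact hs _
    · exact hx
  obtain ⟨σ, hσ⟩ := aux_perm _ _ (hMM v hv)
  obtain ⟨τ, hτ⟩ := aux_perm _ _ (hSS v hv)
  have h1 : μ (fun j => Mstar j v) ≤ μ (fun j => M j v) := by
    rw [← hμsym _ hM σ]
    exact aux_mono hμmono _ _ hMs (fun i => hM _) hσ
  have h2 : μ (padRight (fun j => S j v) (K v)) <
      μ (padRight (fun j => Sstar j v) (Kstar v)) := by
    rw [← hμsym _ (hpad _ _ hSs hKsI) (τ.extendDomain (auxEquiv hmn.le)), ← aux_pad]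
    refine aux_strict hμmono _ _ (hpad _ _ hS hKI) (hpad _ _ (fun j => hSs _) hKsI) ?_
      ⟨m, hmn⟩ ?_
    · intro i
      unfold padRight
      split_ifs
      · exact hτ _
      · exact hlt.le
    · simpa [padRight] using hlt
  rw [hKe, hKse] at h2
  exact absurd h1 (not_le.mpr h2)
end

section
/- Let k ∈ ℕ, I ⊂ ℝ be an interval, μ : I^k → ℝ continuous, symmetric, and strictly increasing in each variable, and S a symmetric continuous k-variable mean on I. Then the function S^{μ} : I^k → I, defined so that S^{μ}(v) is the unique solution x of μ(S(v), x,…,x) = μ(v) (with x repeated k−1 times), is a continuous, symmetric k-variable mean on I. -/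
theorem mu_mono_aux {k : ℕ} {I : Set ℝ} {μ : (Fin k → ℝ) → ℝ}
    (hμmono : ∀ u : Fin k → ℝ, (∀ i, u i ∈ I) → ∀ i : Fin k,
      StrictMonoOn (fun t => μ (Function.update u i t)) I)
    {u w : Fin k → ℝ} (hu : ∀ i, u i ∈ I) (hw : ∀ i, w i ∈ I) (h : ∀ i, u i ≤ w i) :
    μ u ≤ μ w := by
  have key : ∀ s : Finset (Fin k), μ u ≤ μ (s.piecewise w u) := by
    intro s
    induction s using Finset.induction_on with
    | empty => simp
    | insert a s ha ih =>
      refine ih.trans ?_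
      have hp : ∀ i, s.piecewise w u i ∈ I := by
        intro i
        by_cases hi : i ∈ s
        · simpa [hi] using hw i
        · simpa [hi] using hu i
      have h1 := (hμmono _ hp a).monotoneOn (hu a) (hw a) (h a)
      have h2 : Function.update (s.piecewise w u) a (u a) = s.piecewise w u := by
        rw [Function.update_eq_self_iff]
        simp [ha]
      rw [Finset.piecewise_insert]
      simpa only [h2] using h1
  simpa using key Finset.univ

theorem mu_strict_aux {k : ℕ} {I : Set ℝ} {μ : (Fin k → ℝ) → ℝ}
    (hμmono : ∀ u : Fin k → ℝ, (∀ i, u i ∈ I) → ∀ i : Fin k,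
      StrictMonoOn (fun t => μ (Function.update u i t)) I)
    {u w : Fin k → ℝ} (hu : ∀ i, u i ∈ I) (hw : ∀ i, w i ∈ I) (h : ∀ i, u i ≤ w i)
    (j : Fin k) (hj : u j < w j) : μ u < μ w := by
  have h1 := hμmono u hu j (hu j) (hw j) hj
  simp only [Function.update_eq_self] at h1
  refine h1.trans_le (mu_mono_aux hμmono ?_ hw ?_)
  · intro i
    rcases eq_or_ne i j with rfl | hi
    · simpa using hw i
    · simpa [hi] using hu i
  · intro i
    rcases eq_or_ne i j with rfl | hi
    · simp
    · simpa [hi] using h i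

theorem padRight_one_apply {k : ℕ} (s x : ℝ) (i : Fin k) :
    (padRight (fun _ : Fin 1 => s) x : Fin k → ℝ) i = if (i : ℕ) = 0 then s else x := by
  simp [padRight]

/-- for `μ ∈ CS_k(I)` and `S` a symmetric continuous `k`-variable mean
on `I`, the function `S^{μ}` defined by `μ(S(v),x,…,x) = μ(v)` (`x = S^{μ}(v)` repeated
`k-1` times) is a continuous, symmetric `k`-variable mean on `I`. -/
theorem S_mu_is_mean (k : ℕ) (hk : 1 < k) (I : Set ℝ) (hI : I.OrdConnected)
    (μ : (Fin k → ℝ) → ℝ)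
    (hμcont : ContinuousOn μ {u : Fin k → ℝ | ∀ i, u i ∈ I})
    (hμsym : ∀ u : Fin k → ℝ, (∀ i, u i ∈ I) → ∀ σ : Equiv.Perm (Fin k), μ (u ∘ σ) = μ u)
    (hμmono : ∀ u : Fin k → ℝ, (∀ i, u i ∈ I) → ∀ i : Fin k,
      StrictMonoOn (fun t => μ (Function.update u i t)) I)
    (S : (Fin k → ℝ) → ℝ)
    (hSmean : ∀ v : Fin k → ℝ, (∀ i, v i ∈ I) → (⨅ i, v i) ≤ S v ∧ S v ≤ (⨆ i, v i))
    (hSsym : ∀ v : Fin k → ℝ, (∀ i, v i ∈ I) → ∀ σ : Equiv.Perm (Fin k), S (v ∘ σ) = S v)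
    (hScont : ContinuousOn S {v : Fin k → ℝ | ∀ i, v i ∈ I})
    (Sμ : (Fin k → ℝ) → ℝ)
    (hSμ : ∀ v : Fin k → ℝ, (∀ i, v i ∈ I) → Sμ v ∈ I ∧
      μ (padRight (fun _ : Fin 1 => S v) (Sμ v)) = μ v) :
    (∀ v : Fin k → ℝ, (∀ i, v i ∈ I) → (⨅ i, v i) ≤ Sμ v ∧ Sμ v ≤ (⨆ i, v i)) ∧
    (∀ v : Fin k → ℝ, (∀ i, v i ∈ I) → ∀ σ : Equiv.Perm (Fin k), Sμ (v ∘ σ) = Sμ v) ∧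
    ContinuousOn Sμ {v : Fin k → ℝ | ∀ i, v i ∈ I} := by
  have hne : Nonempty (Fin k) := ⟨⟨0, by omega⟩⟩
  have pad_mem : ∀ {s x : ℝ}, s ∈ I → x ∈ I →
      ∀ i, (padRight (fun _ : Fin 1 => s) x : Fin k → ℝ) i ∈ I := by
    intro s x hs hx i
    rw [padRight_one_apply]
    split_ifs <;> assumption
  have pad_le : ∀ {s t x y : ℝ}, s ∈ I → t ∈ I → x ∈ I → y ∈ I → s ≤ t → x ≤ y →
      μ (padRight (fun _ : Fin 1 => s) x) ≤ μ (padRight (fun _ : Fin 1 => t) y) := by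
    intro s t x y hs ht hx hy hst hxy
    refine mu_mono_aux hμmono (pad_mem hs hx) (pad_mem ht hy) ?_
    intro i
    rw [padRight_one_apply, padRight_one_apply]
    split_ifs <;> assumption
  have pad_lt : ∀ {s x y : ℝ}, s ∈ I → x ∈ I → y ∈ I → x < y →
      μ (padRight (fun _ : Fin 1 => s) x) < μ (padRight (fun _ : Fin 1 => s) y) := by
    intro s x y hs hx hy hxy
    refine mu_strict_aux hμmono (pad_mem hs hx) (pad_mem hs hy) ?_ ⟨1, hk⟩ ?_
    · intro i
      rw [padRight_one_apply, padRight_one_apply]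
      split_ifs
      · exact le_rfl
      · exact hxy.le
    · rw [padRight_one_apply, padRight_one_apply]
      simpa using hxy
  have hmin : ∀ v : Fin k → ℝ, ∃ j, v j = ⨅ i, v i := fun v => exists_eq_ciInf_of_finite
  have hmax : ∀ v : Fin k → ℝ, ∃ j, v j = ⨆ i, v i := fun v => exists_eq_ciSup_of_finite
  have hle : ∀ (v : Fin k → ℝ) i, (⨅ i, v i) ≤ v i := fun v i =>
    ciInf_le (Set.finite_range v).bddBelow i
  have hge : ∀ (v : Fin k → ℝ) i, v i ≤ ⨆ i, v i := fun v i =>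
    le_ciSup (Set.finite_range v).bddAbove i
  have hinf : ∀ v : Fin k → ℝ, (∀ i, v i ∈ I) → (⨅ i, v i) ∈ I := by
    intro v hv
    obtain ⟨j, hj⟩ := hmin v
    exact hj ▸ hv j
  have hsup : ∀ v : Fin k → ℝ, (∀ i, v i ∈ I) → (⨆ i, v i) ∈ I := by
    intro v hv
    obtain ⟨j, hj⟩ := hmax v
    exact hj ▸ hv j
  have hSI : ∀ v : Fin k → ℝ, (∀ i, v i ∈ I) → S v ∈ I := fun v hv =>
    hI.out (hinf v hv) (hsup v hv) (hSmean v hv)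
  have swap0 : ∀ (v : Fin k → ℝ) (j i : Fin k), (i : ℕ) = 0 →
      (v ∘ Equiv.swap ⟨0, by omega⟩ j) i = v j := by
    intro v j i hi
    have : i = ⟨0, by omega⟩ := Fin.ext hi
    rw [this]
    simp
  refine ⟨?_, ?_, ?_⟩
  · intro v hv
    obtain ⟨hx, heq⟩ := hSμ v hv
    constructor
    · by_contra! hlt
      obtain ⟨j, hj⟩ := hmax v
      have h1 := pad_lt (hSI v hv) hx (hinf v hv) hlt
      have h2 := pad_le (hSI v hv) (hsup v hv) (hinf v hv) (hinf v hv) (hSmean v hv).2 le_rfl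
      have h3 := mu_mono_aux hμmono (pad_mem (hsup v hv) (hinf v hv))
        (w := v ∘ Equiv.swap ⟨0, by omega⟩ j) (fun i => hv _) (by
          intro i
          rw [padRight_one_apply]
          split_ifs with hi
          · rw [swap0 v j i hi, hj]
          · exact hle v _)
      rw [hμsym v hv] at h3
      linarith
    · by_contra! hlt
      obtain ⟨j, hj⟩ := hmin v
      have h1 := pad_lt (hSI v hv) (hsup v hv) hx hlt
      have h2 := pad_le (hinf v hv) (hSI v hv) (hsup v hv) (hsup v hv) (hSmean v hv).1 le_rfl
      have h3 := mu_mono_aux hμmono (u := v ∘ Equiv.swap ⟨0, by omega⟩ j) (fun i => hv _)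
        (pad_mem (hinf v hv) (hsup v hv)) (by
          intro i
          rw [padRight_one_apply]
          split_ifs with hi
          · rw [swap0 v j i hi, hj]
          · exact hge v _)
      rw [hμsym v hv] at h3
      linarith
  · intro v hv σ
    obtain ⟨hx, heq⟩ := hSμ v hv
    obtain ⟨hx', heq'⟩ := hSμ (v ∘ σ) (fun i => hv _)
    rw [hSsym v hv, hμsym v hv] at heq'
    rcases lt_trichotomy (Sμ (v ∘ σ)) (Sμ v) with h | h | h
    · have := pad_lt (hSI v hv) hx' hx h
      linarith
    · exact h
    · have := pad_lt (hSI v hv) hx hx' h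
      linarith
  · have hcont : ∀ a ∈ I, ContinuousOn
        (fun v : Fin k → ℝ => μ (padRight (fun _ : Fin 1 => S v) a))
        {v : Fin k → ℝ | ∀ i, v i ∈ I} := by
      intro a ha
      refine hμcont.comp (f := fun v : Fin k → ℝ =>
        (padRight (fun _ : Fin 1 => S v) a : Fin k → ℝ)) ?_ (fun v hv => pad_mem (hSI v hv) ha)
      rw [continuousOn_pi]
      intro i
      simp only [padRight_one_apply]
      split_ifs
      · exact hScont
      · exact continuousOn_const
    intro v₀ hv₀
    obtain ⟨hx₀, heq₀⟩ := hSμ v₀ hv₀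
    refine tendsto_order.2 ⟨?_, ?_⟩
    · intro a ha
      by_cases haI : a ∈ I
      · have h0 := pad_lt (hSI v₀ hv₀) haI hx₀ ha
        rw [heq₀] at h0
        filter_upwards [(hcont a haI v₀ hv₀).eventually_lt (hμcont v₀ hv₀) h0,
          self_mem_nhdsWithin] with v h hv
        obtain ⟨hx, heq⟩ := hSμ v hv
        by_contra! hc
        have := pad_le (hSI v hv) (hSI v hv) hx haI le_rfl hc
        linarith
      · filter_upwards [self_mem_nhdsWithin] with v hv
        by_contra! hc
        exact haI (hI.out (hSμ v hv).1 hx₀ ⟨hc, ha.le⟩)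
    · intro a ha
      by_cases haI : a ∈ I
      · have h0 := pad_lt (hSI v₀ hv₀) hx₀ haI ha
        rw [heq₀] at h0
        filter_upwards [(hμcont v₀ hv₀).eventually_lt (hcont a haI v₀ hv₀) h0,
          self_mem_nhdsWithin] with v h hv
        obtain ⟨hx, heq⟩ := hSμ v hv
        by_contra! hc
        have := pad_le (hSI v hv) (hSI v hv) haI hx le_rfl hc
        linarith
      · filter_upwards [self_mem_nhdsWithin] with v hv
        by_contra! hc
        exact haI (hI.out hx₀ (hSμ v hv).1 ⟨ha.le, hc⟩)
end
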